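/- Let 𝔽_q be a finite field of odd characteristic, f ∈ 𝔽_q[x] a monic quadratic with critical point γ and orbit type (3,1), g ∈ 𝔽_q[x] a monic irreducible polynomial of even degree such that g(f²(x)) is irreducible and g(f³(x)) = h(x-γ)h(-(x-γ)) for a monic irreducible h ∈ 𝔽_q[x], all iterates g(f^i(x)) being separable. Then h(b₁-γ)·h(b₂-γ) is a square in 𝔽_q, where b_i = f^i(γ). -/

import Mathlib

open Polynomial

/-- The algebraic core: `(c-β)(a₂-β)` is a square in the big field. -/
lemma core_square {K : Type*} [Field K] [Fintype K] (hchar : ringChar K ≠ 2)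
    (φ : K →+* K) (Q : ℕ) (hφ : ∀ x, φ x = x ^ Q) (hcard : Fintype.card K = Q ^ 4)
    (hQ : Odd Q) (h2 : (2 : K) ^ ((Q - 1) / 2) = 1)
    (c β : K) (hc : c ^ 3 + 2 * c ^ 2 + 2 * c + 2 = 0) (hφc : φ c = c)
    (h0 : φ (((β ^ 2 + c) ^ 2 + c) ^ 2 + c) = ((β ^ 2 + c) ^ 2 + c) ^ 2 + c)
    (hne : φ (φ (β ^ 2 + c)) ≠ β ^ 2 + c) :
    IsSquare ((c - β) * (c ^ 2 + c - β)) := by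
  have two0 : (2 : K) ≠ 0 := Ring.two_ne_zero hchar
  have h4 : ∀ x, φ (φ (φ (φ x))) = x := by
    intro x
    rw [hφ, hφ, hφ, hφ, ← pow_mul, ← pow_mul, ← pow_mul,
      show Q * (Q * (Q * Q)) = Fintype.card K by rw [hcard]; ring]
    exact FiniteField.pow_card x
  obtain ⟨b2, hb2⟩ : ∃ b2, b2 = β ^ 2 + c := ⟨_, rfl⟩
  obtain ⟨b1, hb1⟩ : ∃ b1, b1 = b2 ^ 2 + c := ⟨_, rfl⟩
  rw [← hb2] at hne h0
  rw [← hb1] at h0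
  have h1 : φ b1 = - b1 := by
    have : φ b1 ^ 2 = b1 ^ 2 := by
      simp only [map_add, map_pow, hφc] at h0
      linear_combination h0
    rcases sq_eq_sq_iff_eq_or_eq_neg.mp this with e | e
    · exfalso
      have : φ b2 ^ 2 = b2 ^ 2 := by
        rw [hb1] at e
        simp only [map_add, map_pow, hφc] at e
        linear_combination e
      rcases sq_eq_sq_iff_eq_or_eq_neg.mp this with e | e
      · exact hne (by rw [e, e])
      · exact hne (by rw [e, map_neg, e, neg_neg])
    · exact e
  have h2' : φ (φ b2) = - b2 := by
    have : φ (φ b2) ^ 2 = b2 ^ 2 := by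
      have e : φ (φ b1) = b1 := by rw [h1, map_neg, h1, neg_neg]
      rw [hb1] at e
      simp only [map_add, map_pow, hφc] at e
      linear_combination e
    rcases sq_eq_sq_iff_eq_or_eq_neg.mp this with e | e
    · exact absurd e hne
    · exact e
  -- u and τ
  obtain ⟨u, hu⟩ : ∃ u, u = β * φ (φ β) := ⟨_, rfl⟩
  obtain ⟨τ, hτ⟩ : ∃ τ, τ = φ u := ⟨_, rfl⟩
  have hφτ : φ τ = u := by
    rw [hτ, hu]; simp only [map_mul, h4]; ring
  have hu2 : u ^ 2 = c ^ 2 + c - b1 := by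
    have e := h2'
    rw [hb2] at e
    simp only [map_add, map_pow, hφc] at e
    rw [hu, hb1, hb2]
    linear_combination β ^ 2 * e
  have hτ2 : τ ^ 2 = c ^ 2 + c + b1 := by
    have := congrArg φ hu2
    simp only [map_add, map_sub, map_pow, hφc, h1, ← hτ] at this
    linear_combination this
  obtain ⟨m, hm⟩ : ∃ m, m = -(c + 1) * (c + 2) := ⟨_, rfl⟩
  have hφm : φ m = m := by rw [hm]; simp [hφc, map_ofNat]
  obtain ⟨x, hx⟩ : ∃ x, x = 2 * (b2 + τ + m) := ⟨_, rfl⟩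
  have hx0 : x ≠ 0 := by
    intro e
    have e' : φ (φ x) = 0 := by rw [e]; simp
    rw [hx] at e e'
    simp only [map_mul, map_add, map_ofNat, h2', hφτ, ← hτ, hφm] at e'
    have : 4 * b2 = 0 := by linear_combination e - e'
    have hb : b2 = 0 := by
      have h40 : (4 : K) ≠ 0 := by
        have := mul_ne_zero two0 two0; norm_num at this; exact this
      exact (mul_eq_zero.mp this).resolve_left h40
    exact hne (by rw [hb]; simp)
  have hN : x * φ x * φ (φ x) * φ (φ (φ x)) =
      2 * (4 * (c + 1) * ((c + 2) * (u + τ) - 2 * (c + 1) ^ 2)) ^ 2 := by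
    have e1 : x * φ (φ x) = 4 * (2 * m * τ + 4 * (c + 1) ^ 3) := by
      rw [hx]
      simp only [map_mul, map_add, map_ofNat, h2', hφτ, ← hτ, hφm]
      have : b2 ^ 2 = b1 - c := by rw [hb1]; ring
      rw [hm]
      linear_combination 4 * hτ2 - 4 * this + 4 * c * hc
    have e2 : φ x * φ (φ (φ x)) = 4 * (2 * m * u + 4 * (c + 1) ^ 3) := by
      have := congrArg φ e1
      simp only [map_mul, map_add, map_ofNat, map_pow, map_one, hφτ, hφm, hφc] at this
      exact this
    have : x * φ x * φ (φ x) * φ (φ (φ x)) = (x * φ (φ x)) * (φ x * φ (φ (φ x))) := by ring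
    rw [this, e1, e2, hm]
    linear_combination -32 * (c + 1) ^ 2 * (c + 2) ^ 2 * (hu2 + hτ2) + 64 * (c + 1) ^ 3 * hc
  obtain ⟨n, hn⟩ : ∃ n, n = 4 * (c + 1) * ((c + 2) * (u + τ) - 2 * (c + 1) ^ 2) := ⟨_, rfl⟩
  rw [← hn] at hN
  have hφn : φ n = n := by
    rw [hn]; simp only [map_mul, map_add, map_sub, map_ofNat, map_pow, map_one, hφτ, hφc, ← hτ]
    ring
  have hn0 : n ≠ 0 := by
    rintro rfl
    have : x * φ x * φ (φ x) * φ (φ (φ x)) ≠ 0 := by simp [hx0]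
    exact this (by rw [hN]; ring)
  have hxs : IsSquare x := by
    rw [FiniteField.isSquare_iff hchar hx0, hcard]
    obtain ⟨k, hk⟩ := hQ
    have hk' : (Q - 1) / 2 = k := by omega
    rw [hk'] at h2
    have e : Q ^ 4 / 2 = (1 + Q + Q * Q + Q * Q * Q) * k := by
      have : Q ^ 4 = 2 * ((1 + Q + Q * Q + Q * Q * Q) * k) + 1 := by rw [hk]; ring
      omega
    have e3 : x * φ x * φ (φ x) * φ (φ (φ x)) = x ^ (1 + Q + Q * Q + Q * Q * Q) := by
      rw [hφ (φ (φ x)), hφ (φ x), hφ x]; ring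
    rw [e, pow_mul, ← e3, hN, mul_pow, h2, one_mul, ← pow_mul]
    have : n ^ (2 * k) * n = 1 * n := by
      rw [← pow_succ, ← hk, ← hφ, hφn, one_mul]
    exact mul_right_cancel₀ hn0 this
  obtain ⟨ξ, hξ⟩ := hxs
  have hξ0 : ξ ≠ 0 := by rintro rfl; simp at hξ; exact hx0 hξ
  refine ⟨((c - β) * (c ^ 2 + c - β) + τ) / ξ, ?_⟩
  have : (c - β) * (c ^ 2 + c - β) * x = ((c - β) * (c ^ 2 + c - β) + τ) ^ 2 := by
    rw [hb1, hb2] at hτ2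
    rw [hx, hm, hb2]
    linear_combination -1 * hτ2 +
      (-2 * ((c - β) * (c ^ 2 + c - β)) - c * β ^ 2 + c ^ 3 - c) * hc
  rw [div_mul_div_comm, ← pow_two, ← this, hξ]
  field_simp

lemma eval_eq_norm {F : Type*} [Field F] (h : F[X]) (hm : h.Monic) (hi : Irreducible h) (t : F) :
    haveI := Fact.mk hi
    h.eval t = Algebra.norm F (algebraMap F (AdjoinRoot h) t - AdjoinRoot.root h) := by
  have := Fact.mk hi
  have hmin : minpoly F (AdjoinRoot.root h) = h := by
    rw [AdjoinRoot.minpoly_root hi.ne_zero, hm.leadingCoeff]; simp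
  let pb := AdjoinRoot.powerBasis hi.ne_zero
  have hg : pb.gen = AdjoinRoot.root h := AdjoinRoot.powerBasis_gen hi.ne_zero
  have := charpoly_leftMulMatrix pb
  rw [hg, hmin] at this
  rw [Algebra.norm_eq_matrix_det pb.basis, map_sub]
  have e := congrArg (eval t) this
  rw [Matrix.eval_charpoly] at e
  rw [← e]
  congr 2
  rw [(Algebra.leftMulMatrix pb.basis).commutes t]
  rfl

theorem stmt18 {F : Type*} [Field F] [Fintype F] (hchar : ringChar F ≠ 2)
    (γ c : F) (f : F → F) (hf : ∀ x, f x = (x - γ) ^ 2 + γ + c)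
    (fp : Polynomial F) (hfp : fp = (X - C γ) ^ 2 + C γ + C c)
    (horb : f^[3 + 1] γ = f^[3] γ)
    (hmin : ∀ m' n' : ℕ, 1 ≤ n' → f^[m' + n'] γ = f^[m'] γ → 3 ≤ m' ∧ 1 ≤ n')
    (g : Polynomial F) (hgm : g.Monic) (hgi : Irreducible g) (hgdeg : Even g.natDegree)
    (hsep : ∀ i : ℕ, ((fun p : Polynomial F => p.comp fp)^[i] g).Separable)
    (hirr2 : Irreducible (g.comp (fp.comp fp)))
    (h : Polynomial F) (hhm : h.Monic) (hhi : Irreducible h)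
    (hfac : g.comp (fp.comp (fp.comp fp)) = h.comp (X - C γ) * h.comp (-(X - C γ))) :
    ∃ s : F, h.eval (f^[1] γ - γ) * h.eval (f^[2] γ - γ) = s ^ 2 := by
  have ne1 : f^[2 + 1] γ ≠ f^[2] γ := fun e => by
    have := hmin 2 1 le_rfl e; omega
  have ne2 : f^[0 + 1] γ ≠ f^[0] γ := fun e => by
    have := hmin 0 1 le_rfl e; omega
  simp only [Function.iterate_succ, Function.iterate_zero, Function.comp, id, hf,
    zero_add] at horb ne1 ne2 ⊢
  have hc0 : c ≠ 0 := fun e => ne2 (by rw [e]; ring)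
  have e1 : (γ - γ) ^ 2 + γ + c - γ = c := by ring
  have e2 : (c) ^ 2 + γ + c - γ = c ^ 2 + c := by ring
  simp only [e1, e2] at horb ne1 ⊢
  have hc : c ^ 3 + 2 * c ^ 2 + 2 * c + 2 = 0 := by
    have h3 : ((c ^ 2 + c) ^ 2 + c - (c ^ 2 + c)) * (c * (c ^ 3 + 2 * c ^ 2 + 2 * c + 2)) = 0 := by
      linear_combination horb
    rcases mul_eq_zero.mp h3 with e | e
    · exact absurd (by linear_combination e) ne1
    · exact (mul_eq_zero.mp e).resolve_left hc0
  have := Fact.mk hhi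
  let K := AdjoinRoot h
  let pb := AdjoinRoot.powerBasis hhi.ne_zero
  have : Module.Finite F K := pb.finite
  have : Finite K := Module.finite_of_finite F
  have : Fintype K := Fintype.ofFinite K
  have hinj := (algebraMap F K).injective
  have hcharK : ringChar K ≠ 2 := by
    rwa [← Algebra.ringChar_eq F K]
  have hdfp : fp.natDegree = 2 := by
    rw [hfp]; compute_degree!
  have hne0 : g.comp (fp.comp (fp.comp fp)) ≠ 0 := by
    intro e
    have := congrArg natDegree e
    rw [natDegree_comp, natDegree_comp, natDegree_comp, hdfp, natDegree_zero] at this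
    have := hgi.natDegree_pos
    omega
  have hdh : h.natDegree = 4 * g.natDegree := by
    have := congrArg natDegree hfac
    rw [natDegree_mul, natDegree_comp, natDegree_comp, natDegree_comp, natDegree_comp,
      natDegree_comp, natDegree_neg, natDegree_X_sub_C, hdfp] at this
    · omega
    · exact fun e => hne0 (by rw [hfac, e, zero_mul])
    · exact fun e => hne0 (by rw [hfac, e, mul_zero])
  set q := Fintype.card F with hq
  set d := g.natDegree with hd
  have hcardK : Fintype.card K = (q ^ d) ^ 4 := by
    rw [Module.card_eq_pow_finrank (K := F), pb.finrank, AdjoinRoot.powerBasis_dim, hdh, ← pow_mul,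
      mul_comm]
  have hqodd : Odd q := by
    rw [hq, ← Nat.not_even_iff_odd]
    intro e
    exact hchar (FiniteField.even_card_iff_char_two.mpr (Nat.even_iff.mp e))
  let φ : K →ₐ[F] K := (FiniteField.frobeniusAlgHom F K) ^ d
  have hφ : ∀ x, φ x = x ^ (q ^ d) := by
    intro x
    simp only [φ, AlgHom.coe_pow, FiniteField.coe_frobeniusAlgHom, pow_iterate, hq]
  set β : K := AdjoinRoot.root h with hβ
  set c' : K := algebraMap F K c with hc'
  set γ' : K := algebraMap F K γ with hγ'
  have hfpK : ∀ y : K, aeval (y + γ') fp = y ^ 2 + c' + γ' := by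
    intro y; rw [hfp]; simp [← hc', ← hγ']; ring
  have hr : aeval (β + γ') (g.comp (fp.comp (fp.comp fp))) = 0 := by
    rw [hfac, map_mul, aeval_comp]
    have : aeval (β + γ') (X - C γ) = β := by simp [← hγ']
    rw [this, hβ, AdjoinRoot.aeval_eq, AdjoinRoot.mk_self, zero_mul]
  have hb2 : aeval (β ^ 2 + c' + γ') (g.comp (fp.comp fp)) = 0 := by
    simpa only [aeval_comp, hfpK] using hr
  have hb0 : aeval (((β ^ 2 + c') ^ 2 + c') ^ 2 + c' + γ') g = 0 := by
    simpa only [aeval_comp, hfpK] using hr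
  have hφγ : φ γ' = γ' := φ.commutes γ
  have hφc : φ c' = c' := φ.commutes c
  have hsq : IsSquare ((c' - β) * (c' ^ 2 + c' - β)) := by
    apply core_square hcharK (φ : K →+* K) (q ^ d) hφ hcardK hqodd.pow
    · obtain ⟨k, hk⟩ := hgdeg
      obtain ⟨a, ha⟩ := hqodd
      have hd1 : q ^ 2 - 1 ∣ (q ^ 2) ^ k - 1 := by
        simpa using Nat.sub_dvd_pow_sub_pow (q ^ 2) 1 k
      have hd2 : q ^ 2 - 1 = 2 * ((q - 1) * (a + 1)) := by
        rw [ha, show (2 * a + 1) ^ 2 = 2 * (2 * a * (a + 1)) + 1 by ring]; simp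
      obtain ⟨t, ht⟩ := hd1
      have : (q ^ d - 1) / 2 = (q - 1) * ((a + 1) * t) := by
        rw [hk, ← two_mul, pow_mul, ht, hd2, mul_assoc, Nat.mul_div_cancel_left _ (by norm_num),
          mul_assoc]
      have h2F : (2 : F) ^ (q - 1) = 1 :=
        FiniteField.pow_card_sub_one_eq_one 2 (Ring.two_ne_zero hchar)
      have h2K : (2 : K) ^ (q - 1) = 1 := by
        have := congrArg (algebraMap F K) h2F
        simpa only [map_pow, map_ofNat, map_one] using this
      rw [this, pow_mul, h2K, one_pow]
    · rw [hc']; have := congrArg (algebraMap F K) hc; simpa only [map_add, map_mul, map_pow, map_ofNat, map_zero] using this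
    · exact hφc
    · have hdv : g ∣ X ^ (Nat.card F) ^ d - X :=
        (Irreducible.natDegree_dvd_iff_dvd_X_pow_card_pow_sub_X hgi).mp dvd_rfl
      have := aeval_eq_zero_of_dvd_aeval_eq_zero hdv hb0
      simp only [map_sub, map_pow, aeval_X, Nat.card_eq_fintype_card, ← hq] at this
      rw [← hφ, map_add, hφγ] at this
      show φ _ = _
      linear_combination this
    · intro e
      change φ (φ _) = _ at e
      have hdv : g.comp (fp.comp fp) ∣ X ^ (Nat.card F) ^ (2 * d) - X := by
        have h1 : minpoly F (β ^ 2 + c' + γ') ∣ X ^ (Nat.card F) ^ (2 * d) - X := by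
          apply minpoly.dvd
          simp only [map_sub, map_pow, aeval_X, Nat.card_eq_fintype_card, ← hq]
          rw [two_mul, pow_add, pow_mul, ← hφ, ← hφ, map_add, map_add, hφγ, hφγ, e, sub_self]
        have h2 : minpoly F (β ^ 2 + c' + γ') ∣ g.comp (fp.comp fp) := minpoly.dvd _ _ hb2
        exact (((minpoly.irreducible (Algebra.IsIntegral.isIntegral _)).associated_of_dvd
          hirr2 h2).symm.dvd).trans h1
      have := hirr2.natDegree_dvd_of_dvd_X_pow_card_pow_sub_X hdv
      rw [natDegree_comp, natDegree_comp, hdfp, ← hd] at this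
      have hdpos : 0 < d := hgi.natDegree_pos
      have := Nat.le_of_dvd (by omega) this
      omega
  obtain ⟨s, hs⟩ := hsq
  refine ⟨Algebra.norm F s, ?_⟩
  rw [eval_eq_norm h hhm hhi, eval_eq_norm h hhm hhi, ← map_mul, ← map_pow, pow_two s, ← hs, map_add,
    map_pow]
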